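/- Let h ∈ ℂ[x_1, …, x_n] be weighted homogeneous of weighted degree m with respect to weights m_1, …, m_n, and suppose its Milnor algebra Q(h) is finite-dimensional over ℂ. Set σ := n·m − 2·(m_1 + ⋯ + m_n). Then the graded pieces of the Milnor algebra satisfy the symmetry dim_ℂ Q(h)_k = dim_ℂ Q(h)_{σ−k} for all integers k (where Q(h)_j := 0 for j < 0). (This is the symmetry of spectral numbers α_{h,i} + α_{h,μ_h+1−i} = n for weighted homogeneous isolated singularities.) -/

import Mathlib

open MvPolynomial

/-- The Jacobian ideal of `h`, generated by its partial derivatives. -/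
noncomputable def jacobianIdeal (n : ℕ) (h : MvPolynomial (Fin n) ℂ) :
    Ideal (MvPolynomial (Fin n) ℂ) :=
  Ideal.span (Set.range fun i => MvPolynomial.pderiv i h)

/-- The Milnor algebra `Q(h) = ℂ[x_1,…,x_n]/(∂h/∂x_1,…,∂h/∂x_n)`. -/
noncomputable abbrev milnorAlgebra (n : ℕ) (h : MvPolynomial (Fin n) ℂ) :=
  MvPolynomial (Fin n) ℂ ⧸ jacobianIdeal n h

/-- The weighted-degree-`k` graded piece of the Milnor algebra: the image in `Q(h)` of the
space of weighted homogeneous polynomials of weighted degree `k`. -/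
noncomputable def milnorPiece (n : ℕ) (w : Fin n → ℕ) (h : MvPolynomial (Fin n) ℂ) (k : ℕ) :
    Submodule ℂ (milnorAlgebra n h) :=
  Submodule.map (Ideal.Quotient.mkₐ ℂ (jacobianIdeal n h)).toLinearMap
    (MvPolynomial.weightedHomogeneousSubmodule ℂ w k)

/-- The dimension of the weighted-degree-`j` graded piece of the Milnor algebra, indexed by
an integer `j`, with the convention `Q(h)_j = 0` for `j < 0`. -/
noncomputable def milnorPieceDim (n : ℕ) (w : Fin n → ℕ) (h : MvPolynomial (Fin n) ℂ)
    (j : ℤ) : ℕ :=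
  if 0 ≤ j then Module.finrank ℂ (milnorPiece n w h j.toNat) else 0


section LocalPart
open RingTheory.Sequence IsLocalRing Pointwise

theorem mil_ass_dim {L : Type*} [CommRing L] [IsNoetherianRing L] [IsLocalRing L]
    (rs : List L) : ∀ {M : Type*} [AddCommGroup M] [Module L M] [Module.Finite L M]
    (_ : IsRegular M rs) (_ : ∀ r ∈ rs, r ∈ maximalIdeal L) (P : Ideal L)
    (_ : IsAssociatedPrime P M), (rs.length : WithBot ℕ∞) ≤ ringKrullDim (L ⧸ P) := by
  induction rs with
  | nil =>
    intro M _ _ _ _ _ P hP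
    have := hP.isPrime
    simpa using ringKrullDim_nonneg_of_nontrivial
  | cons a rs ih =>
    intro M _ _ _ hreg hmem P hP
    rw [isRegular_cons_iff] at hreg
    obtain ⟨hPp, x, hx⟩ := isAssociatedPrime_iff.mp hP
    have ha : a ∈ maximalIdeal L := hmem a (by simp)
    have hPx : ∀ p, p ∈ P ↔ p • x = 0 := by
      intro p; rw [hx, Submodule.mem_colon_singleton, Submodule.mem_bot]
    have hx0 : x ≠ 0 := by
      rintro rfl
      exact hPp.ne_top ((Ideal.eq_top_iff_one _).mpr ((hPx 1).mpr (by simp)))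
    let N : Submodule L M := Submodule.torsionBySet L M P
    have hN : ∀ y, y ∈ N ↔ ∀ p ∈ P, p • y = 0 := by
      intro y
      simp only [N, Submodule.mem_torsionBySet_iff]
      exact ⟨fun h p hp => h ⟨p, hp⟩, fun h p => h p p.2⟩
    have hxN : x ∈ N := (hN x).mpr fun p hp => (hPx p).mp hp
    have hex : ∃ y ∈ N, y ∉ (a • ⊤ : Submodule L M) := by
      by_contra hcon
      push Not at hcon
      have hbot : N = ⊥ := by
        refine Submodule.eq_bot_of_le_smul_of_le_jacobson_bot (Ideal.span {a}) N
          (IsNoetherian.noetherian N) ?_ ?_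
        · intro y hy
          obtain ⟨z, -, hz⟩ := (Submodule.mem_smul_pointwise_iff_exists _ _ _).mp (hcon y hy)
          rw [← hz]
          refine Submodule.smul_mem_smul (Ideal.mem_span_singleton_self a) ?_
          rw [hN]
          intro p hp
          apply hreg.1
          simp only [smul_zero]
          rw [smul_comm, hz]
          exact (hN y).mp hy p hp
        · rw [IsLocalRing.jacobson_eq_maximalIdeal ⊥ bot_ne_top, Ideal.span_singleton_le_iff_mem]
          exact ha
      rw [hbot] at hxN
      exact hx0 (by simpa using hxN)
    obtain ⟨y, hyN, hya⟩ := hex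
    have hy0 : (Submodule.Quotient.mk y : QuotSMulTop a M) ≠ 0 := by
      rwa [Ne, Submodule.Quotient.mk_eq_zero]
    obtain ⟨Q, hQ, hle⟩ := exists_le_isAssociatedPrime_of_isNoetherianRing L _ hy0
    have hQp := hQ.isPrime
    have hPQ : P ≤ Q := by
      intro p hp
      apply hle
      rw [Submodule.mem_colon_singleton, Submodule.mem_bot, ← Submodule.Quotient.mk_smul,
        (hN y).mp hyN p hp, Submodule.Quotient.mk_zero]
    have haQ : a ∈ Q := by
      apply hle
      rw [Submodule.mem_colon_singleton, Submodule.mem_bot, ← Submodule.Quotient.mk_smul,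
        Submodule.Quotient.mk_eq_zero]
      exact Submodule.smul_mem_pointwise_smul _ _ _ trivial
    have haP : a ∉ P := by
      intro h
      exact hx0 (hreg.1 (by simpa using (hPx a).mp h))
    have h1 := ih hreg.2 (fun r hr => hmem r (by simp [hr])) Q hQ
    have h2 : ringKrullDim (L ⧸ Q) + 1 ≤ ringKrullDim (L ⧸ P) := by
      refine ringKrullDim_succ_le_of_surjective (Ideal.Quotient.factor hPQ)
        (Ideal.Quotient.factor_surjective hPQ) (r := Ideal.Quotient.mk P a) ?_ ?_
      · rw [mem_nonZeroDivisors_iff_ne_zero, Ne, Ideal.Quotient.eq_zero_iff_mem]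
        exact haP
      · rw [Ideal.Quotient.factor_mk, Ideal.Quotient.eq_zero_iff_mem]
        exact haQ
    refine le_trans ?_ h2
    simp only [List.length_cons, Nat.cast_add, Nat.cast_one]
    gcongr

open CategoryTheory Abelian Limits in
theorem mil_ext_quot {L : Type} [CommRing L] (N M : ModuleCat.{0} L) (f : L)
    (hfreg : IsSMulRegular M f) (d : ℕ) (e1 : ∀ i < d + 1, Subsingleton (Ext N M i)) :
    ∀ i < d, Subsingleton (Ext N (ModuleCat.of L (QuotSMulTop f M)) i) := by
  intro i hi
  have zero1 := AddCommGrpCat.isZero_of_iff_subsingleton.mpr (e1 i (by omega))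
  have zero2 := AddCommGrpCat.isZero_of_iff_subsingleton.mpr (e1 (i + 1) (by omega))
  exact AddCommGrpCat.subsingleton_of_isZero <| ShortComplex.Exact.isZero_of_both_zeros
        ((Ext.covariant_sequence_exact₃' N hfreg.smulShortComplex_shortExact) i (i + 1) rfl)
        (zero1.eq_zero_of_src _) (zero2.eq_zero_of_tgt _)

theorem mil_exchange {L : Type} [CommRing L] [IsNoetherianRing L] [IsLocalRing L]
    {M : Type} [AddCommGroup M] [Module L M] [Module.Finite L M] (rs : List L)
    (hreg : IsRegular M rs) (hmem : ∀ r ∈ rs, r ∈ maximalIdeal L) (f : L)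
    (hf : f ∈ maximalIdeal L) (hfreg : IsSMulRegular M f) (d : ℕ) (hd : rs.length = d + 1) :
    ∃ ss : List L, ss.length = d ∧ (∀ r ∈ ss, r ∈ maximalIdeal L) ∧
      IsRegular (QuotSMulTop f M) ss := by
  have hnt : Nontrivial M := hreg.nontrivial
  have hlt : ∀ (M' : Type) [AddCommGroup M'] [Module L M'] [Module.Finite L M'] [Nontrivial M'],
      (maximalIdeal L) • (⊤ : Submodule L M') < ⊤ := by
    intro M' _ _ _ _
    rw [lt_top_iff_ne_top]
    intro h
    have := Submodule.eq_bot_of_le_smul_of_le_jacobson_bot (maximalIdeal L) (⊤ : Submodule L M')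
      Module.Finite.fg_top h.ge (by rw [IsLocalRing.jacobson_eq_maximalIdeal ⊥ bot_ne_top])
    exact top_ne_bot this
  have hnt' : Nontrivial (QuotSMulTop f M) := nontrivial_quotSMulTop_of_mem_maximalIdeal M hf
  have supp : Module.support L (L ⧸ maximalIdeal L) =
      PrimeSpectrum.zeroLocus (maximalIdeal L : Set L) := by
    rw [Module.support_eq_zeroLocus, Ideal.annihilator_quotient]
  have e1 := ModuleCat.subsingleton_ext_of_exists_isRegular (maximalIdeal L)
    (ModuleCat.of L (L ⧸ maximalIdeal L)) supp.subset (ModuleCat.of L M) (hlt M) rs hmem hreg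
  rw [hd] at e1
  have e2 := mil_ext_quot _ _ f hfreg d e1
  exact ModuleCat.exists_isRegular_of_exists_subsingleton_ext (maximalIdeal L) d
    (ModuleCat.of L (QuotSMulTop f M)) (hlt _) (ModuleCat.of L (L ⧸ maximalIdeal L)) supp e2

theorem mil_sop_regular {L : Type} [CommRing L] [IsNoetherianRing L] [IsLocalRing L]
    (fs : List L) : ∀ {M : Type} [AddCommGroup M] [Module L M] [Module.Finite L M]
    (_ : ∃ rs : List L, rs.length = fs.length ∧ (∀ r ∈ rs, r ∈ maximalIdeal L) ∧ IsRegular M rs)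
    (_ : ∀ r ∈ fs, r ∈ maximalIdeal L)
    (_ : ∀ P : Ideal L, P.IsPrime → Module.annihilator L M ≤ P → (∀ r ∈ fs, r ∈ P) →
      P = maximalIdeal L), IsWeaklyRegular M fs := by
  induction fs with
  | nil => intros; exact IsWeaklyRegular.nil _ _
  | cons f fs ih =>
    intro M _ _ _ hdep hmem hP
    obtain ⟨rs, hlen, hrs, hreg⟩ := hdep
    have hfm := hmem f (by simp)
    have hfreg : IsSMulRegular M f := by
      by_contra hcon
      have : f ∈ ({ r : L | IsSMulRegular M r }ᶜ : Set L) := hcon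
      rw [← biUnion_associatedPrimes_eq_compl_regular] at this
      simp only [Set.mem_iUnion] at this
      obtain ⟨P, hPass, hfP⟩ := this
      have hPp : P.IsPrime := IsAssociatedPrime.isPrime hPass
      have h1 := mil_ass_dim rs hreg hrs P hPass
      classical
      let s : Finset (L ⧸ P) := (fs.map (Ideal.Quotient.mk P)).toFinset
      have : IsLocalRing (L ⧸ P) := IsLocalRing.of_surjective' (Ideal.Quotient.mk P)
        Ideal.Quotient.mk_surjective
      have h2 := ringKrullDim_le_ringKrullDim_quotient_add_card s (by
        intro y hy
        simp only [s, List.coe_toFinset, List.mem_map, Set.mem_ofPred_eq] at hy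
        obtain ⟨z, hz, rfl⟩ := hy
        rw [IsLocalRing.ringJacobson_eq_maximalIdeal]
        have := hmem z (by simp [hz])
        rw [SetLike.mem_coe, IsLocalRing.mem_maximalIdeal, mem_nonunits_iff] at *
        intro hu
        have hl : IsLocalHom (Ideal.Quotient.mk P) :=
          IsLocalHom.of_surjective _ Ideal.Quotient.mk_surjective
        exact this (isUnit_of_map_unit _ _ hu))
      have h3 : ringKrullDim ((L ⧸ P) ⧸ Ideal.span (s : Set (L ⧸ P))) ≤ 0 := by
        have h0 : Ring.KrullDimLE 0 ((L ⧸ P) ⧸ Ideal.span (s : Set (L ⧸ P))) := by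
          rw [Ring.krullDimLE_zero_iff]
          intro I hI
          let φ : L →+* (L ⧸ P) ⧸ Ideal.span (s : Set (L ⧸ P)) :=
            (Ideal.Quotient.mk (Ideal.span (s : Set (L ⧸ P)))).comp (Ideal.Quotient.mk P)
          have hφ : Function.Surjective φ :=
            Ideal.Quotient.mk_surjective.comp Ideal.Quotient.mk_surjective
          have hPφ : ∀ r ∈ P, r ∈ I.comap φ := by
            intro r hr
            have : φ r = 0 := by
              simp [φ, Ideal.Quotient.eq_zero_iff_mem.mpr hr]
            rw [Ideal.mem_comap, this]
            exact I.zero_mem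
          have hmax := hP (I.comap φ) (hI.comap φ)
            (fun r hr => hPφ r (IsAssociatedPrime.annihilator_le hPass (by rwa [Submodule.annihilator_top]))) (by
              intro r hr
              rcases List.mem_cons.mp hr with rfl | hr
              · exact hPφ _ hfP
              · have : φ r = 0 := by
                  simp only [φ, RingHom.comp_apply]
                  rw [Ideal.Quotient.eq_zero_iff_mem]
                  apply Ideal.subset_span
                  simp only [s, List.coe_toFinset, List.mem_map]
                  exact ⟨r, hr, rfl⟩
                rw [Ideal.mem_comap, this]
                exact I.zero_mem)
          rw [← Ideal.map_comap_of_surjective φ hφ I]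
          have hm : (I.comap φ).IsMaximal := by rw [hmax]; infer_instance
          refine (Ideal.map_eq_top_or_isMaximal_of_surjective φ hφ hm).resolve_left ?_
          rw [Ideal.map_comap_of_surjective φ hφ I]
          exact hI.ne_top
        exact_mod_cast (Ring.krullDimLE_iff.mp h0)
      have h4 : s.card ≤ fs.length := by
        refine (List.toFinset_card_le _).trans ?_
        simp
      have h5 : ((fs.length + 1 : ℕ) : WithBot ℕ∞) ≤ (fs.length : ℕ) := by
        calc ((fs.length + 1 : ℕ) : WithBot ℕ∞) = rs.length := by rw [hlen]; simp
          _ ≤ _ := h1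
          _ ≤ _ := h2
          _ ≤ 0 + (fs.length : ℕ) := by gcongr
          _ = _ := by simp
      norm_cast at h5
      omega
    rw [isWeaklyRegular_cons_iff]
    refine ⟨hfreg, ih ?_ (fun r hr => hmem r (by simp [hr])) ?_⟩
    · obtain ⟨ss, h⟩ := mil_exchange rs hreg hrs f hfm hfreg fs.length (by simpa using hlen)
      exact ⟨ss, h⟩
    · intro P hPp hann hPfs
      refine hP P hPp (fun r hr => hann ?_) ?_
      · rw [Module.mem_annihilator] at hr ⊢
        intro m
        obtain ⟨m, rfl⟩ := Submodule.Quotient.mk_surjective _ m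
        rw [← Submodule.Quotient.mk_smul, hr m, Submodule.Quotient.mk_zero]
      · intro r hr
        rcases List.mem_cons.mp hr with rfl | hr
        · apply hann
          rw [Module.mem_annihilator]
          intro m
          obtain ⟨m, rfl⟩ := Submodule.Quotient.mk_surjective _ m
          rw [← Submodule.Quotient.mk_smul, Submodule.Quotient.mk_eq_zero]
          exact Submodule.smul_mem_pointwise_smul _ _ _ trivial
        · exact hPfs r hr

end LocalPart

section PolyPart
open RingTheory.Sequence IsLocalRing Pointwise

theorem mil_ofList_take {A : Type*} [CommRing A] {n : ℕ} (g : Fin n → A) (i : Fin n) :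
    Ideal.ofList ((List.ofFn g).take i) = Ideal.span (g '' {j | j < i}) := by
  unfold Ideal.ofList
  congr 1
  ext r
  simp only [Set.mem_ofPred_eq, List.mem_take_iff_getElem, Set.mem_image, List.getElem_ofFn,
    List.length_ofFn]
  constructor
  · rintro ⟨k, hk, rfl⟩
    exact ⟨⟨k, by omega⟩, by simp [Fin.lt_def]; omega, rfl⟩
  · rintro ⟨j, hj, rfl⟩
    have : (j : ℕ) < i := hj
    exact ⟨j, by omega, rfl⟩

theorem mil_weaklyRegular_iff {A : Type*} [CommRing A] {n : ℕ} (g : Fin n → A) :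
    IsWeaklyRegular A (List.ofFn g) ↔ ∀ i y, g i * y ∈ Ideal.span (g '' {j | j < i}) →
      y ∈ Ideal.span (g '' {j | j < i}) := by
  have key : ∀ i : Fin n, IsSMulRegular (A ⧸ (Ideal.ofList ((List.ofFn g).take i) • ⊤ :
      Submodule A A)) (g i) ↔ ∀ y, g i * y ∈ Ideal.span (g '' {j | j < i}) →
      y ∈ Ideal.span (g '' {j | j < i}) := by
    intro i
    rw [isSMulRegular_quotient_iff_mem_of_smul_mem, mil_ofList_take]
    simp
  rw [isWeaklyRegular_iff]
  constructor
  · intro h i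
    rw [← key i]
    simpa using h i (by simp)
  · intro h i hi
    have := (key ⟨i, by simpa using hi⟩).mpr (h _)
    simpa using this

theorem mil_X_regular (n : ℕ) :
    IsWeaklyRegular (MvPolynomial (Fin n) ℂ) (List.ofFn fun i => (X i : MvPolynomial (Fin n) ℂ)) := by
  rw [mil_weaklyRegular_iff]
  intro i y hy
  rw [mem_ideal_span_X_image] at hy ⊢
  intro m hm
  obtain ⟨j, hj, hj0⟩ := hy (Finsupp.single i 1 + m) (by
    rw [mem_support_iff, coeff_X_mul]; exact mem_support_iff.mp hm)
  refine ⟨j, hj, ?_⟩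
  have : i ≠ j := (ne_of_lt hj).symm
  simpa [Finsupp.single_apply, this] using hj0

theorem mil_sop {n : ℕ} (f : Fin n → MvPolynomial (Fin n) ℂ)
    (hf : ∀ i, constantCoeff (f i) = 0)
    [FiniteDimensional ℂ (MvPolynomial (Fin n) ℂ ⧸ Ideal.span (Set.range f))]
    (i : Fin n) (y : MvPolynomial (Fin n) ℂ) (hy : f i * y ∈ Ideal.span (f '' {j | j < i})) :
    ∃ s, constantCoeff s ≠ 0 ∧ s * y ∈ Ideal.span (f '' {j | j < i}) := by
  let m : Ideal (MvPolynomial (Fin n) ℂ) := RingHom.ker (constantCoeff)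
  have hmmax : m.IsMaximal := RingHom.ker_isMaximal_of_surjective _ (fun c => ⟨C c, constantCoeff_C _ c⟩)
  let L := Localization.AtPrime m
  have hmem : ∀ p : MvPolynomial (Fin n) ℂ, constantCoeff p = 0 →
      algebraMap _ L p ∈ maximalIdeal L := by
    intro p hp
    rw [IsLocalization.AtPrime.to_map_mem_maximal_iff L m]
    exact hp
  have hXreg : IsRegular L ((List.ofFn fun i => (X i : MvPolynomial (Fin n) ℂ)).map
      (algebraMap _ L)) := by
    refine (mil_X_regular n).isRegular_of_isLocalization_of_mem L m ?_
    intro r hr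
    obtain ⟨j, rfl⟩ := (List.mem_ofFn' _ _).mp hr
    simp [m]
  have hnoeth : IsNoetherianRing L := IsLocalization.isNoetherianRing m.primeCompl L inferInstance
  have hreg : IsWeaklyRegular L (List.ofFn fun i => algebraMap _ L (f i)) := by
    refine mil_sop_regular _ ⟨_, by simp, ?_, hXreg⟩ ?_ ?_
    · intro r hr
      obtain ⟨p, hp, rfl⟩ := List.mem_map.mp hr
      obtain ⟨j, rfl⟩ := (List.mem_ofFn' _ _).mp hp
      exact hmem _ (by simp)
    · intro r hr
      obtain ⟨j, rfl⟩ := (List.mem_ofFn' _ _).mp hr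
      exact hmem _ (hf j)
    · intro P hP _ hPf
      have hJ : Ideal.span (Set.range f) ≤ P.comap (algebraMap _ L) := by
        rw [Ideal.span_le]
        rintro _ ⟨j, rfl⟩
        exact hPf _ ((List.mem_ofFn' _ _).mpr ⟨j, rfl⟩)
      have hPc : (P.comap (algebraMap (MvPolynomial (Fin n) ℂ) L)).IsPrime := hP.comap _
      have hfin : FiniteDimensional ℂ (MvPolynomial (Fin n) ℂ ⧸ P.comap (algebraMap _ L)) :=
        Module.Finite.of_surjective (Ideal.Quotient.factorₐ ℂ hJ).toLinearMap
          (Ideal.Quotient.factor_surjective hJ)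
      have hmax : (P.comap (algebraMap (MvPolynomial (Fin n) ℂ) L)).IsMaximal := by
        apply Ideal.Quotient.maximal_of_isField
        exact (Algebra.IsIntegral.isField_iff_isField (R := ℂ)
          (algebraMap ℂ _).injective).mp (Field.toIsField ℂ)
      have hle : P.comap (algebraMap (MvPolynomial (Fin n) ℂ) L) ≤ m := by
        have := Ideal.comap_mono (f := algebraMap (MvPolynomial (Fin n) ℂ) L)
          (IsLocalRing.le_maximalIdeal hP.ne_top)
        exact this.trans_eq (IsLocalization.AtPrime.under_maximalIdeal L m)
      have heq := hmax.eq_of_le hmmax.ne_top hle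
      rw [← IsLocalization.map_under m.primeCompl L P]
      refine (congrArg (Ideal.map (algebraMap _ L)) heq).trans ?_
      exact Localization.AtPrime.map_eq_maximalIdeal
  rw [mil_weaklyRegular_iff] at hreg
  have himg : Ideal.span ((fun i => algebraMap _ L (f i)) '' {j | j < i}) =
      Ideal.map (algebraMap _ L) (Ideal.span (f '' {j | j < i})) := by
    rw [Ideal.map_span, Set.image_image]
  have h2 := hreg i (algebraMap _ L y) (by
    rw [himg, ← map_mul]; exact Ideal.mem_map_of_mem _ hy)
  rw [himg, IsLocalization.algebraMap_mem_map_algebraMap_iff m.primeCompl] at h2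
  obtain ⟨s, hs, hsy⟩ := h2
  exact ⟨s, hs, hsy⟩

end PolyPart

section HilbertPart

theorem mil_comp_mul_left {n : ℕ} (w : Fin n → ℕ) {f g : MvPolynomial (Fin n) ℂ} {d : ℕ}
    (hf : IsWeightedHomogeneous w f d) (k : ℕ) :
    weightedHomogeneousComponent w k (f * g) =
      if d ≤ k then f * weightedHomogeneousComponent w (k - d) g else 0 := by
  let _ := weightedGradedAlgebra ℂ w
  have h := DirectSum.coe_decompose_mul_of_left_mem (weightedHomogeneousSubmodule ℂ w)
    (a := f) (b := g) (i := d) k hf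
  have e : ∀ (p : MvPolynomial (Fin n) ℂ) (j : ℕ),
      (DirectSum.decompose (weightedHomogeneousSubmodule ℂ w) p j : MvPolynomial (Fin n) ℂ) =
        weightedHomogeneousComponent w j p :=
    fun p j => weightedDecomposition.decompose'_apply ℂ w p j
  rw [e, e] at h
  exact h

/-- Closed under weighted homogeneous components. -/
def MilHom {n : ℕ} (w : Fin n → ℕ) (J : Ideal (MvPolynomial (Fin n) ℂ)) : Prop :=
  ∀ p ∈ J, ∀ k, weightedHomogeneousComponent w k p ∈ J

theorem mil_hom_span {n : ℕ} (w : Fin n → ℕ) (s : Set (MvPolynomial (Fin n) ℂ))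
    (hs : ∀ x ∈ s, ∃ d, IsWeightedHomogeneous w x d) : MilHom w (Ideal.span s) := by
  let _ := weightedGradedAlgebra ℂ w
  intro p hp k
  refine weightedHomogeneousComponent_mem_of_mem ℂ w ?_ hp k
  refine Ideal.homogeneous_span _ _ ?_
  intro x hx
  obtain ⟨d, hd⟩ := hs x hx
  exact ⟨d, hd⟩

/-- The graded piece of a quotient. -/
noncomputable def milPc {n : ℕ} (w : Fin n → ℕ) (J : Ideal (MvPolynomial (Fin n) ℂ)) (k : ℕ) :
    Submodule ℂ (MvPolynomial (Fin n) ℂ ⧸ J) :=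
  Submodule.map (Ideal.Quotient.mkₐ ℂ J).toLinearMap (weightedHomogeneousSubmodule ℂ w k)

theorem milPc_mem {n : ℕ} {w : Fin n → ℕ} {J : Ideal (MvPolynomial (Fin n) ℂ)} {k : ℕ}
    {x : MvPolynomial (Fin n) ℂ ⧸ J} :
    x ∈ milPc w J k ↔ ∃ p, IsWeightedHomogeneous w p k ∧ Ideal.Quotient.mk J p = x := Iff.rfl

theorem milPc_finite {n : ℕ} {w : Fin n → ℕ} (hw : ∀ i, 0 < w i)
    (J : Ideal (MvPolynomial (Fin n) ℂ)) (k : ℕ) : FiniteDimensional ℂ (milPc w J k) :=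
  Module.Finite.iff_fg.mpr
    ((weightedHomogeneousSubmodule_fg ℂ w (fun i => (hw i).ne') k).map _)

theorem mil_rank_step {n : ℕ} {w : Fin n → ℕ} (hw : ∀ i, 0 < w i)
    (J J' : Ideal (MvPolynomial (Fin n) ℂ)) (hJ : MilHom w J) (f : MvPolynomial (Fin n) ℂ) (d : ℕ)
    (hf : IsWeightedHomogeneous w f d) (hJ' : J' = Ideal.span {f} ⊔ J)
    (hreg : ∀ e y, IsWeightedHomogeneous w y e → f * y ∈ J → y ∈ J) (k : ℕ) :
    Module.finrank ℂ (milPc w J k) = Module.finrank ℂ (milPc w J' k) +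
      if d ≤ k then Module.finrank ℂ (milPc w J (k - d)) else 0 := by
  have hle : J ≤ J' := hJ' ▸ le_sup_right
  have hfJ' : f ∈ J' := hJ' ▸ (le_sup_left : Ideal.span {f} ≤ _) (Ideal.mem_span_singleton_self f)
  have := milPc_finite hw J k
  let φ : (MvPolynomial (Fin n) ℂ ⧸ J) →ₗ[ℂ] (MvPolynomial (Fin n) ℂ ⧸ J') :=
    (Ideal.Quotient.factorₐ ℂ hle).toLinearMap
  have hφ : ∀ p, φ (Ideal.Quotient.mk J p) = Ideal.Quotient.mk J' p := fun p => rfl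
  let ψ := φ.domRestrict (milPc w J k)
  have h1 := LinearMap.finrank_range_add_finrank_ker ψ
  have hr : LinearMap.range ψ = milPc w J' k := by
    rw [LinearMap.range_domRestrict]
    ext x
    simp only [Submodule.mem_map, milPc_mem]
    constructor
    · rintro ⟨_, ⟨p, hp, rfl⟩, rfl⟩
      exact ⟨p, hp, rfl⟩
    · rintro ⟨p, hp, rfl⟩
      exact ⟨_, ⟨p, hp, rfl⟩, rfl⟩
  rw [hr] at h1
  rw [← h1]
  congr 1
  have hker : ∀ p, IsWeightedHomogeneous w p k → p ∈ J' →
      p - (if d ≤ k then f * weightedHomogeneousComponent w (k - d)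
        (Classical.epsilon fun g => p - f * g ∈ J) else 0) ∈ J := by
    intro p hp hpJ'
    have hex : ∃ g, p - f * g ∈ J := by
      rw [hJ', Submodule.mem_sup] at hpJ'
      obtain ⟨a, ha, b, hb, rfl⟩ := hpJ'
      obtain ⟨g, rfl⟩ := Ideal.mem_span_singleton.mp ha
      exact ⟨g, by simpa using hb⟩
    have hg := Classical.epsilon_spec hex
    have := hJ _ hg k
    rw [map_sub, mil_comp_mul_left w hf, weightedHomogeneousComponent_eq_self hp] at this
    exact this
  split_ifs with hdk
  · simp only [hdk, if_true] at hker
    let μ : (MvPolynomial (Fin n) ℂ ⧸ J) →ₗ[ℂ] (MvPolynomial (Fin n) ℂ ⧸ J) :=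
      LinearMap.mulLeft ℂ (Ideal.Quotient.mk J f)
    let ν := μ.domRestrict (milPc w J (k - d))
    have hinj : Function.Injective ν := by
      rw [← LinearMap.ker_eq_bot, LinearMap.ker_eq_bot']
      rintro ⟨x, hx⟩ h0
      obtain ⟨p, hp, rfl⟩ := milPc_mem.mp hx
      have h0' : Ideal.Quotient.mk J f * Ideal.Quotient.mk J p = 0 := h0
      rw [← map_mul, Ideal.Quotient.eq_zero_iff_mem] at h0'
      apply Subtype.ext
      exact Ideal.Quotient.eq_zero_iff_mem.mpr (hreg _ p hp h0')
    rw [← LinearMap.finrank_range_of_inj hinj,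
      ← Submodule.finrank_map_subtype_eq (milPc w J k) (LinearMap.ker ψ)]
    have : Submodule.map (milPc w J k).subtype (LinearMap.ker ψ) = LinearMap.range ν := by
      rw [LinearMap.range_domRestrict]
      ext x
      simp only [Submodule.mem_map, LinearMap.mem_ker]
      constructor
      · rintro ⟨⟨_, hx⟩, h0, rfl⟩
        obtain ⟨p, hp, rfl⟩ := milPc_mem.mp hx
        have h0' : Ideal.Quotient.mk J' p = 0 := h0
        rw [Ideal.Quotient.eq_zero_iff_mem] at h0'
        refine ⟨_, milPc_mem.mpr ⟨_, weightedHomogeneousComponent_isWeightedHomogeneous (k - d)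
          (Classical.epsilon fun g => p - f * g ∈ J), rfl⟩, ?_⟩
        have := Ideal.Quotient.eq.mpr (hker p hp h0')
        rw [map_mul] at this
        exact this.symm
      · rintro ⟨_, hx, rfl⟩
        obtain ⟨p, hp, rfl⟩ := milPc_mem.mp hx
        refine ⟨⟨Ideal.Quotient.mk J (f * p), milPc_mem.mpr ⟨f * p, ?_, rfl⟩⟩, ?_, ?_⟩
        · have := hf.mul hp
          rwa [Nat.add_sub_cancel' hdk] at this
        · change Ideal.Quotient.mk J' (f * p) = 0
          exact Ideal.Quotient.eq_zero_iff_mem.mpr (J'.mul_mem_right _ hfJ')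
        · exact map_mul (Ideal.Quotient.mk J) f p
    rw [this]
  · simp only [hdk, if_false, sub_zero] at hker
    have : LinearMap.ker ψ = ⊥ := by
      rw [LinearMap.ker_eq_bot']
      rintro ⟨x, hx⟩ h0
      obtain ⟨p, hp, rfl⟩ := milPc_mem.mp hx
      have h0' : Ideal.Quotient.mk J' p = 0 := h0
      rw [Ideal.Quotient.eq_zero_iff_mem] at h0'
      apply Subtype.ext
      exact Ideal.Quotient.eq_zero_iff_mem.mpr (hker p hp h0')
    rw [this, finrank_bot]

/-- Hilbert series. -/
noncomputable def milH {n : ℕ} (w : Fin n → ℕ) (J : Ideal (MvPolynomial (Fin n) ℂ)) :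
    PowerSeries ℤ := PowerSeries.mk fun k => (Module.finrank ℂ (milPc w J k) : ℤ)

theorem milH_step {n : ℕ} {w : Fin n → ℕ} (hw : ∀ i, 0 < w i)
    (J J' : Ideal (MvPolynomial (Fin n) ℂ)) (hJ : MilHom w J) (f : MvPolynomial (Fin n) ℂ) (d : ℕ)
    (hf : IsWeightedHomogeneous w f d) (hJ' : J' = Ideal.span {f} ⊔ J)
    (hreg : ∀ e y, IsWeightedHomogeneous w y e → f * y ∈ J → y ∈ J) :
    milH w J' = (1 - PowerSeries.X ^ d) * milH w J := by
  ext k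
  rw [sub_mul, one_mul, map_sub, PowerSeries.coeff_X_pow_mul']
  simp only [milH, PowerSeries.coeff_mk]
  rw [mil_rank_step hw J J' hJ f d hf hJ' hreg k]
  split_ifs <;> simp

theorem milH_sop {n : ℕ} {w : Fin n → ℕ} (hw : ∀ i, 0 < w i)
    (f : Fin n → MvPolynomial (Fin n) ℂ) (d : Fin n → ℕ)
    (hf : ∀ i, IsWeightedHomogeneous w (f i) (d i))
    (hf0 : ∀ i, constantCoeff (f i) = 0)
    [FiniteDimensional ℂ (MvPolynomial (Fin n) ℂ ⧸ Ideal.span (Set.range f))] :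
    milH w (Ideal.span (Set.range f)) = (∏ i, (1 - PowerSeries.X ^ d i)) * milH w ⊥ := by
  have key : ∀ k : ℕ, k ≤ n → milH w (Ideal.span (f '' {j | (j : ℕ) < k})) =
      (∏ i with i.val < k, (1 - PowerSeries.X ^ d i)) * milH w ⊥ := by
    intro k
    induction k with
    | zero => intro _; simp
    | succ k ih =>
      intro hk
      let i : Fin n := ⟨k, hk⟩
      have hset : {j : Fin n | (j : ℕ) < k + 1} =
          (insert i {j : Fin n | (j : ℕ) < k} : Set (Fin n)) := by
        ext j; simp [i, Fin.ext_iff]; omega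
      have hfs : (Finset.univ.filter fun j : Fin n => (j : ℕ) < k + 1) =
          insert i (Finset.univ.filter fun j : Fin n => (j : ℕ) < k) := by
        ext j; simp [i, Fin.ext_iff]; omega
      have hset' : {j : Fin n | (j : ℕ) < k} = {j | j < i} := by
        ext j; simp [i, Fin.lt_def]
      have hhom : MilHom w (Ideal.span (f '' {j | (j : ℕ) < k})) := by
        apply mil_hom_span
        rintro _ ⟨j, -, rfl⟩
        exact ⟨_, hf j⟩
      rw [milH_step hw (Ideal.span (f '' {j | (j : ℕ) < k})) _ hhom (f i) (d i) (hf i)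
        (by rw [hset, Set.image_insert_eq, Ideal.span_insert]) ?_, ih (by omega), hfs,
        Finset.prod_insert (by simp [i]), mul_assoc]
      intro e y hy hfy
      rw [hset'] at hfy
      obtain ⟨s, hs, hsy⟩ := mil_sop f hf0 i y hfy
      rw [← hset', mul_comm] at hsy
      have := hhom _ hsy e
      rw [mil_comp_mul_left w hy, if_pos le_rfl, Nat.sub_self,
        weightedHomogeneousComponent_zero _ (fun i => (hw i).ne')] at this
      have h2 := Ideal.mul_mem_right (C (coeff 0 s)⁻¹) _ this
      have hs' : coeff 0 s ≠ 0 := hs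
      rwa [mul_assoc, ← C_mul, mul_inv_cancel₀ hs', C_1, mul_one] at h2
  have := key n le_rfl
  simpa using this

theorem milH_X {n : ℕ} {w : Fin n → ℕ} (hw : ∀ i, 0 < w i) :
    (∏ i, (1 - PowerSeries.X ^ w i)) * milH w ⊥ = 1 := by
  let I : Ideal (MvPolynomial (Fin n) ℂ) := Ideal.span (Set.range X)
  have hmem : ∀ p : MvPolynomial (Fin n) ℂ, p ∈ I ↔ constantCoeff p = 0 := by
    intro p
    have : I = Ideal.span (X '' Set.univ) := by rw [Set.image_univ]
    rw [this, mem_ideal_span_X_image]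
    constructor
    · intro h
      by_contra h0
      obtain ⟨i, -, hi⟩ := h 0 (mem_support_iff.mpr h0)
      simp at hi
    · intro h m hm
      by_contra hcon
      push Not at hcon
      have : m = 0 := by ext i; simpa using hcon i trivial
      subst this
      exact mem_support_iff.mp hm h
  have hmk : ∀ p : MvPolynomial (Fin n) ℂ, Ideal.Quotient.mk I p =
      constantCoeff p • (1 : MvPolynomial (Fin n) ℂ ⧸ I) := by
    intro p
    have : constantCoeff p • (1 : MvPolynomial (Fin n) ℂ ⧸ I) =
        Ideal.Quotient.mk I (C (constantCoeff p)) := by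
      rw [← mul_one (C (constantCoeff p)), ← smul_eq_C_mul]; rfl
    rw [this, Ideal.Quotient.eq, hmem]
    simp
  have htop : Submodule.span ℂ {(1 : MvPolynomial (Fin n) ℂ ⧸ I)} = ⊤ := by
    rw [eq_top_iff]
    rintro x -
    obtain ⟨p, rfl⟩ := Ideal.Quotient.mk_surjective x
    rw [hmk]
    exact Submodule.smul_mem _ _ (Submodule.mem_span_singleton_self _)
  have : FiniteDimensional ℂ (MvPolynomial (Fin n) ℂ ⧸ I) := by
    refine Module.finite_def.mpr ?_
    rw [← htop]
    exact Submodule.fg_span_singleton _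
  have h1 := milH_sop hw (fun i => (X i : MvPolynomial (Fin n) ℂ)) w
    (fun i => isWeightedHomogeneous_X ℂ w i) (fun i => by simp)
  rw [← h1]
  change milH w I = 1
  ext k
  simp only [milH, PowerSeries.coeff_mk, PowerSeries.coeff_one]
  split_ifs with hk
  · subst hk
    have h3 : milPc w I 0 = Submodule.span ℂ {(1 : MvPolynomial (Fin n) ℂ ⧸ I)} := by
      rw [htop, eq_top_iff, ← htop, Submodule.span_singleton_le_iff_mem]
      exact milPc_mem.mpr ⟨1, isWeightedHomogeneous_one ℂ w, map_one _⟩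
    have h1ne : (1 : MvPolynomial (Fin n) ℂ ⧸ I) ≠ 0 := by
      rw [← map_one (Ideal.Quotient.mk I), Ne, Ideal.Quotient.eq_zero_iff_mem, hmem]
      simp
    rw [h3, finrank_span_singleton h1ne, Nat.cast_one]
  · have h3 : milPc w I k = ⊥ := by
      rw [eq_bot_iff]
      intro x hx
      obtain ⟨p, hp, rfl⟩ := milPc_mem.mp hx
      have : constantCoeff p = 0 := by
        by_contra h0
        exact hk (by simpa using (hp (d := 0) h0).symm)
      rw [hmk, this, zero_smul]
      exact Submodule.zero_mem _
    rw [h3, finrank_bot, Nat.cast_zero]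

theorem mil_eventually_zero {n : ℕ} {w : Fin n → ℕ}
    (J : Ideal (MvPolynomial (Fin n) ℂ)) (hJ : MilHom w J)
    [FiniteDimensional ℂ (MvPolynomial (Fin n) ℂ ⧸ J)] :
    {k | milPc w J k ≠ ⊥}.Finite := by
  have hex : ∀ k : {k | milPc w J k ≠ ⊥}, ∃ p, IsWeightedHomogeneous w p (k : ℕ) ∧ p ∉ J := by
    rintro ⟨k, hk⟩
    obtain ⟨x, hx, hx0⟩ := Submodule.exists_mem_ne_zero_of_ne_bot hk
    obtain ⟨p, hp, rfl⟩ := milPc_mem.mp hx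
    exact ⟨p, hp, fun h => hx0 (Ideal.Quotient.eq_zero_iff_mem.mpr h)⟩
  choose p hp hpJ using hex
  have hli : LinearIndependent ℂ (fun k => Ideal.Quotient.mk J (p k)) := by
    rw [linearIndependent_iff']
    intro s g hg i hi
    have h1 : (∑ k ∈ s, C (g k) * p k) ∈ J := by
      rw [← Ideal.Quotient.eq_zero_iff_mem, map_sum, ← hg]
      refine Finset.sum_congr rfl fun k _ => ?_
      rw [← smul_eq_C_mul]; rfl
    have h2 := hJ _ h1 i
    rw [map_sum, Finset.sum_eq_single i] at h2
    · rw [weightedHomogeneousComponent_C_mul, weightedHomogeneousComponent_eq_self (hp i)] at h2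
      by_contra h0
      have h3 := Ideal.mul_mem_left _ (C (g i)⁻¹) h2
      rw [← mul_assoc, ← C_mul, inv_mul_cancel₀ h0, C_1, one_mul] at h3
      exact hpJ i h3
    · intro j _ hji
      rw [weightedHomogeneousComponent_C_mul,
        (hp j).weightedHomogeneousComponent_ne _ (fun h => hji (Subtype.ext h.symm)), mul_zero]
    · intro h; exact absurd hi h
  exact Set.finite_coe_iff.mp hli.finite_of_isNoetherian

end HilbertPart

section FinalPart

theorem mil_natDegree_one_sub {w : ℕ} (hw : 0 < w) :
    ((1 : Polynomial ℤ) - Polynomial.X ^ w).natDegree = w := by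
  rw [Polynomial.natDegree_sub_eq_right_of_natDegree_lt] <;> simp [hw]

theorem mil_one_sub_ne {w : ℕ} (hw : 0 < w) : ((1 : Polynomial ℤ) - Polynomial.X ^ w) ≠ 0 := by
  intro h
  have := mil_natDegree_one_sub hw
  rw [h] at this
  simp at this
  omega

theorem mil_reverse_one_sub {w : ℕ} (hw : 0 < w) :
    ((1 : Polynomial ℤ) - Polynomial.X ^ w).reverse = -(1 - Polynomial.X ^ w) := by
  rw [Polynomial.reverse, mil_natDegree_one_sub hw, Polynomial.reflect_sub,
    Polynomial.reflect_monomial, Polynomial.reflect_one, Polynomial.revAt_le le_rfl]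
  simp

theorem mil_reverse_prod {n : ℕ} (w : Fin n → ℕ) (hw : ∀ i, 0 < w i) (s : Finset (Fin n)) :
    (∏ i ∈ s, ((1 : Polynomial ℤ) - Polynomial.X ^ w i)).reverse =
      (-1) ^ s.card * ∏ i ∈ s, ((1 : Polynomial ℤ) - Polynomial.X ^ w i) := by
  induction s using Finset.induction_on with
  | empty =>
    have := Polynomial.reverse_C (1 : ℤ)
    simpa using this
  | insert a s ha ih =>
    rw [Finset.prod_insert ha, Polynomial.reverse_mul_of_domain, ih, mil_reverse_one_sub (hw a),
      Finset.card_insert_of_notMem ha, pow_succ]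
    ring

theorem mil_palindrome {n : ℕ} (w d : Fin n → ℕ) (hw : ∀ i, 0 < w i) (hd : ∀ i, 0 < d i)
    (q : Polynomial ℤ)
    (hq : (∏ i, ((1 : Polynomial ℤ) - Polynomial.X ^ w i)) * q =
      ∏ i, ((1 : Polynomial ℤ) - Polynomial.X ^ d i)) :
    q.reverse = q ∧ (∑ i, w i) + q.natDegree = ∑ i, d i := by
  have hA : ∀ w : Fin n → ℕ, (∀ i, 0 < w i) →
      (∏ i, ((1 : Polynomial ℤ) - Polynomial.X ^ w i)) ≠ 0 := fun w hw =>
    Finset.prod_ne_zero_iff.mpr fun i _ => mil_one_sub_ne (hw i)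
  have hD : ∀ w : Fin n → ℕ, (∀ i, 0 < w i) →
      (∏ i, ((1 : Polynomial ℤ) - Polynomial.X ^ w i)).natDegree = ∑ i, w i := fun w hw => by
    rw [Polynomial.natDegree_prod _ _ fun i _ => mil_one_sub_ne (hw i)]
    exact Finset.sum_congr rfl fun i _ => mil_natDegree_one_sub (hw i)
  have hq0 : q ≠ 0 := by
    rintro rfl
    rw [mul_zero] at hq
    exact hA d hd hq.symm
  constructor
  · have h := congrArg Polynomial.reverse hq
    rw [Polynomial.reverse_mul_of_domain, mil_reverse_prod w hw, mil_reverse_prod d hd, ← hq,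
      mul_assoc] at h
    have h1 := mul_left_cancel₀ (pow_ne_zero _ (neg_ne_zero.mpr one_ne_zero)) h
    exact mul_left_cancel₀ (hA w hw) h1
  · rw [← hD w hw, ← hD d hd, ← hq, Polynomial.natDegree_mul (hA w hw) hq0]

theorem mil_pderiv_hom {n m : ℕ} {w : Fin n → ℕ} {h : MvPolynomial (Fin n) ℂ}
    (hwh : IsWeightedHomogeneous w h m) (i : Fin n) :
    IsWeightedHomogeneous w (pderiv i h) (m - w i) := by
  by_cases hi : w i ≤ m
  · exact hwh.pderiv (Nat.sub_add_cancel hi)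
  · have : pderiv i h = 0 := by
      apply pderiv_eq_zero_of_notMem_vars
      intro hv
      obtain ⟨e, he, hei⟩ := mem_vars i |>.mp hv
      have h1 := hwh (mem_support_iff.mp he)
      have h2 := Finsupp.le_weight_of_ne_zero' (w := w) (Finsupp.mem_support_iff.mp hei)
      omega
    rw [this]
    exact isWeightedHomogeneous_zero ℂ w _

end FinalPart

/-- If `h` is weighted homogeneous of weighted degree `m` for positive weights `w i` with
finite dimensional Milnor algebra, and `σ := n·m - 2·(w 1 + ⋯ + w n)`, then
`dim_ℂ Q(h)_k = dim_ℂ Q(h)_{σ-k}` for all integers `k` (the symmetry of the spectral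
numbers of a weighted homogeneous isolated singularity). -/
theorem milnor_piece_symmetry (n : ℕ) (hn : 1 ≤ n)
    (m : ℕ) (hm : 0 < m) (w : Fin n → ℕ) (hw : ∀ i, 0 < w i)
    (h : MvPolynomial (Fin n) ℂ)
    (hwh : MvPolynomial.IsWeightedHomogeneous w h m)
    [FiniteDimensional ℂ (milnorAlgebra n h)] (k : ℤ) :
    milnorPieceDim n w h k =
      milnorPieceDim n w h ((n : ℤ) * (m : ℤ) - 2 * (∑ i, (w i : ℤ)) - k) := by
  have hf : ∀ i, IsWeightedHomogeneous w (pderiv i h) (m - w i) := mil_pderiv_hom hwh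
  have hfin : FiniteDimensional ℂ (MvPolynomial (Fin n) ℂ ⧸
    Ideal.span (Set.range fun i => pderiv i h)) :=
    ‹FiniteDimensional ℂ (milnorAlgebra n h)›
  have hdim : ∀ j : ℤ, (milnorPieceDim n w h j : ℤ) =
      if 0 ≤ j then PowerSeries.coeff j.toNat
        (milH w (Ideal.span (Set.range fun i => pderiv i h))) else 0 := by
    intro j
    unfold milnorPieceDim
    split_ifs
    · rw [milH, PowerSeries.coeff_mk]; rfl
    · rfl
  have hhom : MilHom w (Ideal.span (Set.range fun i => pderiv i h)) := by
    apply mil_hom_span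
    rintro _ ⟨i, rfl⟩
    exact ⟨_, hf i⟩
  have hzero : milH w (Ideal.span (Set.range fun i => pderiv i h)) = 0 →
      milnorPieceDim n w h k =
        milnorPieceDim n w h ((n : ℤ) * (m : ℤ) - 2 * (∑ i, (w i : ℤ)) - k) := by
    intro h0
    apply Nat.cast_injective (R := ℤ)
    rw [hdim, hdim, h0]
    simp
  by_cases hc : ∀ i, constantCoeff (pderiv i h) = 0
  swap
  · apply hzero
    push Not at hc
    obtain ⟨i, hi⟩ := hc
    have h1 := hhom _ (Ideal.subset_span ⟨i, rfl⟩) 0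
    rw [weightedHomogeneousComponent_zero _ (fun i => (hw i).ne')] at h1
    have h2 : Ideal.span (Set.range fun i => pderiv i h) = ⊤ :=
      Ideal.eq_top_of_isUnit_mem _ h1 ((isUnit_iff_ne_zero.mpr hi).map C)
    have : Subsingleton (MvPolynomial (Fin n) ℂ ⧸
        Ideal.span (Set.range fun i => pderiv i h)) :=
      Ideal.Quotient.subsingleton_iff.mpr h2
    ext j
    rw [milH, PowerSeries.coeff_mk, Module.finrank_zero_of_subsingleton]
    simp
  have hS := milH_sop hw (fun i => pderiv i h) (fun i => m - w i) hf hc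
  have hX := milH_X hw
  by_cases hd : ∀ i, 0 < m - w i
  swap
  · apply hzero
    push Not at hd
    obtain ⟨i, hi⟩ := hd
    rw [hS, Finset.prod_eq_zero (Finset.mem_univ i), zero_mul]
    rw [Nat.le_zero.mp hi, pow_zero, sub_self]
  obtain ⟨N, hN⟩ := (mil_eventually_zero (w := w) _ hhom).bddAbove
  set H := milH w (Ideal.span (Set.range fun i => pderiv i h)) with hH
  have hHN : ∀ j, N < j → PowerSeries.coeff j H = 0 := by
    intro j hj
    have : milPc w (Ideal.span (Set.range fun i => pderiv i h)) j = ⊥ := by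
      by_contra hne
      have := hN hne
      omega
    rw [hH, milH, PowerSeries.coeff_mk, this, finrank_bot, Nat.cast_zero]
  let q : Polynomial ℤ := PowerSeries.trunc (N + 1) H
  have hqc : ∀ j, q.coeff j = PowerSeries.coeff j H := by
    intro j
    rw [PowerSeries.coeff_trunc]
    split_ifs with hj
    · rfl
    · exact (hHN j (by omega)).symm
  have hqH : (q : PowerSeries ℤ) = H := by
    ext j
    rw [Polynomial.coeff_coe, hqc]
  have hprod : ∀ v : Fin n → ℕ, ((∏ i, ((1 : Polynomial ℤ) - Polynomial.X ^ v i) :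
      Polynomial ℤ) : PowerSeries ℤ) = ∏ i, (1 - PowerSeries.X ^ v i) := by
    intro v
    rw [← Polynomial.coeToPowerSeries.ringHom_apply, map_prod]
    simp
  obtain ⟨hrev, hdeg⟩ := mil_palindrome w (fun i => m - w i) hw hd q (by
    apply Polynomial.coe_injective
    rw [Polynomial.coe_mul, hprod, hprod, hqH, hS, mul_left_comm, hX, mul_one])
  have hσ : (n : ℤ) * (m : ℤ) - 2 * (∑ i, (w i : ℤ)) = q.natDegree := by
    have h1 : (∑ i, ((m - w i : ℕ) : ℤ)) = (n : ℤ) * m - ∑ i, (w i : ℤ) := by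
      have : ∀ i, ((m - w i : ℕ) : ℤ) = (m : ℤ) - w i := fun i =>
        Nat.cast_sub (by have := hd i; omega)
      simp [this]
    have h2 : (∑ i, (w i : ℤ)) + q.natDegree = ∑ i, ((m - w i : ℕ) : ℤ) := by
      exact_mod_cast hdeg
    linarith
  apply Nat.cast_injective (R := ℤ)
  rw [hdim, hdim, hσ]
  simp only [← hqc]
  split_ifs with h1 h2 h2
  · have h3 : k.toNat ≤ q.natDegree := by omega
    conv_lhs => rw [← hrev]
    rw [Polynomial.coeff_reverse, Polynomial.revAt_le h3]
    congr 1
    omega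
  · exact Polynomial.coeff_eq_zero_of_natDegree_lt (by omega)
  · exact (Polynomial.coeff_eq_zero_of_natDegree_lt (by omega)).symm
  · rfl
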